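/- Existence of a classical solution to the regularized HJB equation: for every ε > 0 there exists a function u : [0,∞) × ℝ → ℝ such that (i) u is continuous on [0,∞) × ℝ with u(0,z) = 0 for all z ∈ ℝ; (ii) u has continuous partial derivatives ∂_t u, ∂_z u and ∂_zz u on (0,∞) × ℝ; (iii) u satisfies ∂_t u(t,z) = (σ²/2)·∂_zz u(t,z) + G_ε(z) + (γ²/(4κ))·(∂_z u(t,z))² for all t > 0 and z ∈ ℝ; (iv) u(t, c+x) = u(t, c−x) for all t ≥ 0 and x ∈ ℝ, and in particular u satisfies the Neumann boundary condition ∂_z u(t,c) = 0 for all t > 0; (v) u ≥ 0 everywhere; and (vi) for every T > 0, ∂_z u is bounded on (0,T] × ℝ. -/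

import Mathlib

open MeasureTheory ProbabilityTheory Filter Topology Set

/-- The heat semigroup on the line: `heat σ τ f z` is the expectation of `f (z + σ √τ Y)` for a
standard Gaussian `Y`. It is the identity for `τ ≤ 0`. -/
noncomputable def heat (σ τ : ℝ) (f : ℝ → ℝ) (z : ℝ) : ℝ :=
  ∫ y, f (z + σ * √τ * y) ∂gaussianReal 0 1

lemma heat_of_nonpos (σ : ℝ) {τ : ℝ} (hτ : τ ≤ 0) (f : ℝ → ℝ) (z : ℝ) :
    heat σ τ f z = f z := by
  simp [heat, Real.sqrt_eq_zero_of_nonpos hτ]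

lemma heat_nonneg (σ τ : ℝ) {f : ℝ → ℝ} (hf : ∀ z, 0 ≤ f z) (z : ℝ) : 0 ≤ heat σ τ f z :=
  integral_nonneg fun _ => hf _

lemma abs_heat_le (σ τ : ℝ) {f : ℝ → ℝ} {b : ℝ} (hf : ∀ z, |f z| ≤ b) (z : ℝ) :
    |heat σ τ f z| ≤ b := by
  simpa [heat] using norm_integral_le_of_norm_le_const (μ := gaussianReal 0 1)
    (f := fun y => f (z + σ * √τ * y)) (C := b) (Eventually.of_forall fun y => hf _)

lemma heat_reflect (σ τ c : ℝ) {f : ℝ → ℝ} (hf : ∀ x, f (c + x) = f (c - x)) (x : ℝ) :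
    heat σ τ f (c + x) = heat σ τ f (c - x) := by
  have h : (gaussianReal 0 1).map (fun y => -y) = gaussianReal 0 1 := by
    simp [gaussianReal_map_neg]
  have h2 := integral_map_equiv (μ := gaussianReal 0 1) (MeasurableEquiv.neg ℝ)
    (fun y => f (c + x + σ * √τ * y))
  change ∫ y, _ ∂((gaussianReal 0 1).map (fun y => -y)) = _ at h2
  rw [h] at h2
  rw [heat, h2, heat]
  refine integral_congr_ae (Eventually.of_forall fun y => ?_)
  have := hf (x - σ * √τ * y)
  simp only [MeasurableEquiv.neg_apply]
  convert this using 2 <;> ring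

lemma integrable_gaussianReal_of_bounded {f : ℝ → ℝ} (hf : Continuous f) {b : ℝ}
    (hb : ∀ y, |f y| ≤ b) : Integrable f (gaussianReal 0 1) :=
  Integrable.of_bound hf.aestronglyMeasurable b (Eventually.of_forall hb)

lemma continuous_heat (σ : ℝ) {f : ℝ → ℝ → ℝ} {B : ℝ → ℝ}
    (hf : Continuous fun p : ℝ × ℝ => f p.1 p.2) (hB : Continuous B)
    (hb : ∀ s z, |f s z| ≤ B s) :
    Continuous fun p : ℝ × ℝ × ℝ => heat σ p.1 (f p.2.1) p.2.2 := by
  rw [continuous_iff_continuousAt]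
  rintro ⟨τ₀, s₀, z₀⟩
  have hg : Continuous fun q : (ℝ × ℝ × ℝ) × ℝ => f q.1.2.1 (q.1.2.2 + σ * √q.1.1 * q.2) :=
    hf.comp (by fun_prop : Continuous fun q : (ℝ × ℝ × ℝ) × ℝ =>
      (q.1.2.1, q.1.2.2 + σ * √q.1.1 * q.2))
  refine continuousAt_of_dominated (bound := fun _ => B s₀ + 1) ?_ ?_ (integrable_const _) ?_
  · exact Eventually.of_forall fun p =>
      (hg.comp (by fun_prop : Continuous fun y : ℝ => (p, y))).aestronglyMeasurable
  · have h1 : ∀ᶠ p : ℝ × ℝ × ℝ in 𝓝 (τ₀, s₀, z₀), B p.2.1 < B s₀ + 1 :=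
      (hB.comp (by fun_prop : Continuous fun p : ℝ × ℝ × ℝ => p.2.1)).continuousAt.eventually_lt
        continuousAt_const (by simp)
    filter_upwards [h1] with p hp
    exact Eventually.of_forall fun y => (hb _ _).trans hp.le
  · exact Eventually.of_forall fun y =>
      (hg.comp (by fun_prop : Continuous fun p : ℝ × ℝ × ℝ => (p, y))).continuousAt

lemma hasDerivAt_heat (σ τ : ℝ) {f f' : ℝ → ℝ} (hf : ∀ z, HasDerivAt f (f' z) z)
    (hf' : Continuous f') {b : ℝ} (hb : ∀ z, |f z| ≤ b) (hb' : ∀ z, |f' z| ≤ b) (z : ℝ) :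
    HasDerivAt (heat σ τ f) (heat σ τ f' z) z := by
  have hfc : Continuous f := continuous_iff_continuousAt.2 fun z => (hf z).continuousAt
  refine (hasDerivAt_integral_of_dominated_loc_of_deriv_le (bound := fun _ => b)
    (F := fun z y => f (z + σ * √τ * y)) (F' := fun z y => f' (z + σ * √τ * y)) univ_mem
    ?_ ?_ ?_ ?_ (integrable_const _) ?_).2
  · exact Eventually.of_forall fun w => (by fun_prop : Continuous _).aestronglyMeasurable
  · exact integrable_gaussianReal_of_bounded (by fun_prop) fun y => hb _
  · exact (by fun_prop : Continuous _).aestronglyMeasurable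
  · exact Eventually.of_forall fun y w _ => hb' _
  · exact Eventually.of_forall fun y w _ => (hf _).comp_add_const w _

lemma hasDerivAt_gaussianPDFReal (y : ℝ) :
    HasDerivAt (gaussianPDFReal 0 1) (-y * gaussianPDFReal 0 1 y) y := by
  have h : gaussianPDFReal 0 1 = fun x => (√(2 * Real.pi))⁻¹ * Real.exp (-x ^ 2 / 2) := by
    ext x; simp [gaussianPDFReal]
  rw [h]
  have h1 : HasDerivAt (fun x : ℝ => -x ^ 2 / 2) (-y) y := by
    exact ((hasDerivAt_pow 2 y).neg.div_const 2).congr_deriv (by simp; ring)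
  exact (h1.exp.const_mul (√(2 * Real.pi))⁻¹).congr_deriv (by ring)

lemma integrable_abs_gaussianReal : Integrable (fun y : ℝ => |y|) (gaussianReal 0 1) :=
  ((memLp_id_gaussianReal (μ := 0) (v := 1) 1).integrable (by simp)).abs

/-- Gaussian integration by parts. -/
lemma integral_mul_gaussianReal_eq_integral_deriv {g g' : ℝ → ℝ}
    (hg : ∀ y, HasDerivAt g (g' y) y) (hg' : Continuous g') {b : ℝ} (hb : ∀ y, |g y| ≤ b)
    (hb' : ∀ y, |g' y| ≤ b) :
    ∫ y, g y * y ∂gaussianReal 0 1 = ∫ y, g' y ∂gaussianReal 0 1 := by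
  have hgc : Continuous g := continuous_iff_continuousAt.2 fun z => (hg z).continuousAt
  have hi1 : Integrable (fun y => g y * y) (gaussianReal 0 1) := by
    refine (integrable_abs_gaussianReal.const_mul b).mono'
      (by fun_prop : Continuous _).aestronglyMeasurable (Eventually.of_forall fun y => ?_)
    rw [Real.norm_eq_abs, abs_mul]
    exact mul_le_mul_of_nonneg_right (hb y) (abs_nonneg y)
  have hi2 := integrable_gaussianReal_of_bounded hg' hb'
  have hi3 := integrable_gaussianReal_of_bounded hgc hb
  have key : ∀ f : ℝ → ℝ, Integrable f (gaussianReal 0 1) →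
      Integrable (fun y => gaussianPDFReal 0 1 y * f y) := by
    intro f hf
    rw [gaussianReal_of_var_ne_zero 0 one_ne_zero,
      integrable_withDensity_iff_integrable_smul' (measurable_gaussianPDF 0 1)
        (Eventually.of_forall fun _ => gaussianPDF_lt_top)] at hf
    simpa using hf
  have h0 := integral_eq_zero_of_hasDerivAt_of_integrable
    (f := fun y => gaussianPDFReal 0 1 y * g y)
    (f' := fun y => gaussianPDFReal 0 1 y * (g' y - g y * y))
    (fun y => by
      exact ((hasDerivAt_gaussianPDFReal y).mul (hg y)).congr_deriv (by ring))
    (key _ (hi2.sub hi1)) (key _ hi3)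
  have h1 := integral_gaussianReal_eq_integral_smul (μ := 0) (v := 1) one_ne_zero
    (f := fun y => g' y - g y * y)
  simp only [smul_eq_mul] at h1
  rw [h0, integral_sub hi2 hi1] at h1
  linarith

lemma hasDerivAt_heat_time (σ : ℝ) {τ : ℝ} (hτ : 0 < τ) {f f' f'' : ℝ → ℝ}
    (hf : ∀ z, HasDerivAt f (f' z) z) (hf' : ∀ z, HasDerivAt f' (f'' z) z)
    (hf'' : Continuous f'') {b : ℝ} (hb : ∀ z, |f z| ≤ b) (hb' : ∀ z, |f' z| ≤ b)
    (hb'' : ∀ z, |f'' z| ≤ b) (z : ℝ) :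
    HasDerivAt (fun τ => heat σ τ f z) (σ ^ 2 / 2 * heat σ τ f'' z) τ := by
  have hfc : Continuous f := continuous_iff_continuousAt.2 fun z => (hf z).continuousAt
  have hfc' : Continuous f' := continuous_iff_continuousAt.2 fun z => (hf' z).continuousAt
  have hb0 : 0 ≤ b := (abs_nonneg _).trans (hb 0)
  have h1 : ∀ a : ℝ, HasDerivAt (fun a : ℝ => ∫ y, f (z + a * y) ∂gaussianReal 0 1)
      (∫ y, f' (z + a * y) * y ∂gaussianReal 0 1) a := by
    intro a
    refine (hasDerivAt_integral_of_dominated_loc_of_deriv_le (bound := fun y => b * |y|)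
      (F := fun a y => f (z + a * y)) (F' := fun a y => f' (z + a * y) * y) univ_mem
      ?_ ?_ ?_ ?_ (integrable_abs_gaussianReal.const_mul b) ?_).2
    · exact Eventually.of_forall fun w => (by fun_prop : Continuous _).aestronglyMeasurable
    · exact integrable_gaussianReal_of_bounded (by fun_prop) fun y => hb _
    · exact (by fun_prop : Continuous _).aestronglyMeasurable
    · refine Eventually.of_forall fun y w _ => ?_
      rw [Real.norm_eq_abs, abs_mul]
      exact mul_le_mul_of_nonneg_right (hb' _) (abs_nonneg y)
    · refine Eventually.of_forall fun y w _ => ?_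
      have h : HasDerivAt (fun a : ℝ => z + a * y) y w := by
        simpa using ((hasDerivAt_id w).mul_const y).const_add z
      exact (hf _).comp w h
  have h2 : ∀ a : ℝ, ∫ y, f' (z + a * y) * y ∂gaussianReal 0 1
      = a * ∫ y, f'' (z + a * y) ∂gaussianReal 0 1 := by
    intro a
    rw [← integral_const_mul]
    refine integral_mul_gaussianReal_eq_integral_deriv (b := b + |a| * b) (fun y => ?_)
      (by fun_prop) (fun y => ?_) fun y => ?_
    · have h : HasDerivAt (fun y : ℝ => z + a * y) a y := by
        simpa using ((hasDerivAt_id y).const_mul a).const_add z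
      exact ((hf' _).comp y h).congr_deriv (by ring)
    · exact (hb' _).trans (by nlinarith [abs_nonneg a])
    · rw [abs_mul]
      nlinarith [abs_nonneg a, mul_le_mul_of_nonneg_left (hb'' (z + a * y)) (abs_nonneg a)]
  have h3 : HasDerivAt (fun τ : ℝ => σ * √τ) (σ * (1 / (2 * √τ))) τ :=
    (Real.hasDerivAt_sqrt hτ.ne').const_mul σ
  have h4 := (h1 (σ * √τ)).comp τ h3
  rw [h2] at h4
  have : √τ ≠ 0 := (Real.sqrt_pos.2 hτ).ne'
  refine h4.congr_deriv ?_
  rw [heat]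
  field_simp

lemma heat_eq_add_integral (σ : ℝ) {τ : ℝ} (hτ : 0 ≤ τ) {f f' f'' : ℝ → ℝ}
    (hf : ∀ z, HasDerivAt f (f' z) z) (hf' : ∀ z, HasDerivAt f' (f'' z) z)
    (hf'' : Continuous f'') {b : ℝ} (hb : ∀ z, |f z| ≤ b) (hb' : ∀ z, |f' z| ≤ b)
    (hb'' : ∀ z, |f'' z| ≤ b) (z : ℝ) :
    heat σ τ f z = f z + ∫ r in (0 : ℝ)..τ, σ ^ 2 / 2 * heat σ r f'' z := by
  have hfc : Continuous f := continuous_iff_continuousAt.2 fun z => (hf z).continuousAt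
  have hc : ∀ g : ℝ → ℝ, Continuous g → (∀ z, |g z| ≤ b) →
      Continuous fun r => heat σ r g z := fun g hg hgb =>
    (continuous_heat σ (f := fun _ => g) (by fun_prop) (continuous_const (y := b))
      fun _ => hgb).comp (by fun_prop : Continuous fun r : ℝ => (r, (0 : ℝ), z))
  rw [intervalIntegral.integral_eq_sub_of_hasDerivAt_of_le hτ (hc f hfc hb).continuousOn
    (fun r hr => hasDerivAt_heat_time σ hr.1 hf hf' hf'' hb hb' hb'' z)
    (((hc f'' hf'' hb'').const_mul _).intervalIntegrable _ _), heat_of_nonpos σ le_rfl]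
  ring

/-- Leibniz rule for an integral whose endpoint and integrand depend on the parameter. -/
lemma hasDerivAt_integral_zero_self {F F' : ℝ → ℝ → ℝ}
    (hF : Continuous fun p : ℝ × ℝ => F p.1 p.2) (hF' : Continuous fun p : ℝ × ℝ => F' p.1 p.2)
    (h : ∀ t s, HasDerivAt (fun t => F t s) (F' t s) t) (t : ℝ) :
    HasDerivAt (fun t => ∫ s in (0 : ℝ)..t, F t s) (F t t + ∫ s in (0 : ℝ)..t, F' t s) t := by
  have hc1 : ∀ b, Continuous (F b) := fun b =>
    hF.comp (by fun_prop : Continuous fun s : ℝ => (b, s))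
  have hc2 : ∀ b, Continuous (F' b) := fun b =>
    hF'.comp (by fun_prop : Continuous fun s : ℝ => (b, s))
  let K : ℝ → ℝ → ℝ := fun a b => ∫ s in (0 : ℝ)..a, F b s
  let K₁ : ℝ → ℝ → ℝ →L[ℝ] ℝ := fun a b => ContinuousLinearMap.toSpanSingleton ℝ (F b a)
  let K₂ : ℝ → ℝ → ℝ →L[ℝ] ℝ := fun a b =>
    ContinuousLinearMap.toSpanSingleton ℝ (∫ s in (0 : ℝ)..a, F' b s)
  have hK := hasStrictFDerivAt_uncurry_coprod (u := (t, t)) (f := K) (f₁ := K₁) (f₂ := K₂)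
    (Eventually.of_forall fun v => ?_) (Eventually.of_forall fun v => ?_) ?_ ?_
  · have hd : HasDerivAt (fun t : ℝ => (t, t)) (1, 1) t :=
      (hasDerivAt_id t).prodMk (hasDerivAt_id t)
    have := HasFDerivAt.comp_hasDerivAt (f := fun t : ℝ => (t, t)) t hK.hasFDerivAt hd
    simpa [K₁, K₂, K, Function.HasUncurry.uncurry, Function.comp_def] using this
  · exact (intervalIntegral.integral_hasDerivAt_right ((hc1 _).intervalIntegrable _ _)
      ((hc1 _).stronglyMeasurableAtFilter _ _) (hc1 _).continuousAt).hasFDerivAt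
  · obtain ⟨C, hC⟩ := ((isCompact_Icc (a := v.2 - 1) (b := v.2 + 1)).prod
      (isCompact_uIcc (a := 0) (b := v.1))).exists_bound_of_continuousOn hF'.continuousOn
    refine (intervalIntegral.hasDerivAt_integral_of_dominated_loc_of_deriv_le
      (bound := fun _ => C) (F := F) (F' := F') (Icc_mem_nhds (sub_one_lt v.2) (lt_add_one v.2))
      (Eventually.of_forall fun b => (hc1 b).aestronglyMeasurable)
      ((hc1 _).intervalIntegrable _ _) (hc2 _).aestronglyMeasurable
      (Eventually.of_forall fun s hs b hb => ?_) (by simp)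
      (Eventually.of_forall fun s _ b _ => h b s)).2.hasFDerivAt
    exact hC (b, s) ⟨hb, uIoc_subset_uIcc hs⟩
  · exact ((ContinuousLinearMap.toSpanSingletonCLE (𝕜 := ℝ) (E := ℝ)).continuous.comp
      (hF.comp continuous_swap)).continuousAt
  · refine ((ContinuousLinearMap.toSpanSingletonCLE (𝕜 := ℝ) (E := ℝ)).continuous.comp
      (?_ : Continuous fun v : ℝ × ℝ => ∫ s in (0 : ℝ)..v.1, F' v.2 s)).continuousAt
    exact intervalIntegral.continuous_parametric_intervalIntegral_of_continuous
      (f := fun (v : ℝ × ℝ) s => F' v.2 s)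
      (hF'.comp (by fun_prop : Continuous fun q : (ℝ × ℝ) × ℝ => (q.1.2, q.2))) continuous_fst

/-- `f` is a jointly continuous function of time and space with bounded continuous spatial
derivatives `f₁`, `f₂`, all three being bounded by `B t` at time `t`. -/
structure SpatialC2 (B : ℝ → ℝ) (f f₁ f₂ : ℝ → ℝ → ℝ) : Prop where
  cont : Continuous fun p : ℝ × ℝ => f p.1 p.2
  cont₁ : Continuous fun p : ℝ × ℝ => f₁ p.1 p.2
  cont₂ : Continuous fun p : ℝ × ℝ => f₂ p.1 p.2
  hasDerivAt : ∀ t z, HasDerivAt (f t) (f₁ t z) z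
  hasDerivAt₁ : ∀ t z, HasDerivAt (f₁ t) (f₂ t z) z
  bound : ∀ t z, |f t z| ≤ B t
  bound₁ : ∀ t z, |f₁ t z| ≤ B t
  bound₂ : ∀ t z, |f₂ t z| ≤ B t

/-- The Duhamel integral `∫₀ᵗ P_{t-s} f(s) ds` for the heat semigroup. -/
noncomputable def duhamel (σ : ℝ) (f : ℝ → ℝ → ℝ) (t z : ℝ) : ℝ :=
  ∫ s in (0 : ℝ)..t, heat σ (t - s) (f s) z

section Duhamel

variable {σ : ℝ} {f f₁ f₂ : ℝ → ℝ → ℝ} {B : ℝ → ℝ}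

lemma continuous_duhamel_integrand (hf : Continuous fun p : ℝ × ℝ => f p.1 p.2)
    (hB : Continuous B) (hb : ∀ s z, |f s z| ≤ B s) :
    Continuous fun q : (ℝ × ℝ) × ℝ => heat σ (q.1.1 - q.2) (f q.2) q.1.2 :=
  (continuous_heat σ hf hB hb).comp
    (by fun_prop : Continuous fun q : (ℝ × ℝ) × ℝ => (q.1.1 - q.2, q.2, q.1.2))

lemma continuous_duhamel (hf : Continuous fun p : ℝ × ℝ => f p.1 p.2)
    (hB : Continuous B) (hb : ∀ s z, |f s z| ≤ B s) :
    Continuous fun p : ℝ × ℝ => duhamel σ f p.1 p.2 :=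
  intervalIntegral.continuous_parametric_intervalIntegral_of_continuous
    (f := fun (p : ℝ × ℝ) s => heat σ (p.1 - s) (f s) p.2)
    (continuous_duhamel_integrand hf hB hb) continuous_fst

lemma hasDerivAt_duhamel (hf : Continuous fun p : ℝ × ℝ => f p.1 p.2)
    (hf₁ : Continuous fun p : ℝ × ℝ => f₁ p.1 p.2)
    (hd : ∀ t z, HasDerivAt (f t) (f₁ t z) z) (hB : Continuous B) (hb : ∀ s z, |f s z| ≤ B s)
    (hb₁ : ∀ s z, |f₁ s z| ≤ B s) (t z : ℝ) :
    HasDerivAt (duhamel σ f t) (duhamel σ f₁ t z) z := by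
  have hc : ∀ {g : ℝ → ℝ → ℝ}, Continuous (fun p : ℝ × ℝ => g p.1 p.2) →
      (∀ s z, |g s z| ≤ B s) → ∀ w, Continuous fun s => heat σ (t - s) (g s) w :=
    fun hg hgb w => (continuous_duhamel_integrand hg hB hgb).comp
      (by fun_prop : Continuous fun s : ℝ => ((t, w), s))
  refine (intervalIntegral.hasDerivAt_integral_of_dominated_loc_of_deriv_le (bound := B)
    (F := fun w s => heat σ (t - s) (f s) w) (F' := fun w s => heat σ (t - s) (f₁ s) w)
    univ_mem (Eventually.of_forall fun w => (hc hf hb w).aestronglyMeasurable)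
    ((hc hf hb z).intervalIntegrable _ _) (hc hf₁ hb₁ z).aestronglyMeasurable
    (Eventually.of_forall fun s _ w _ => abs_heat_le _ _ (hb₁ s) w) (hB.intervalIntegrable _ _)
    (Eventually.of_forall fun s _ w _ => ?_)).2
  exact hasDerivAt_heat σ (t - s) (hd s) (hf₁.comp (by fun_prop : Continuous fun z : ℝ => (s, z)))
    (hb s) (hb₁ s) w

lemma abs_duhamel_le {K : ℝ} {n : ℕ} (hb : ∀ s z, |f s z| ≤ K * |s| ^ n) (t z : ℝ) :
    |duhamel σ f t z| ≤ K / (n + 1) * |t| ^ (n + 1) := by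
  calc |duhamel σ f t z| ≤ ∫ s in uIoc 0 t, K * |s| ^ n := by
        rw [duhamel, ← Real.norm_eq_abs, intervalIntegral.norm_integral_eq_norm_integral_uIoc]
        refine norm_integral_le_of_norm_le (g := fun s => K * |s| ^ n)
          (f := fun s => heat σ (t - s) (f s) z) ?_
          (Eventually.of_forall fun s => abs_heat_le _ _ (hb s) z)
        exact (by fun_prop : Continuous fun s : ℝ => K * |s| ^ n).integrableOn_uIoc
    _ = K / (n + 1) * |t| ^ (n + 1) := by
        have := integral_pow_abs_sub_uIoc (a := 0) (b := t) (n := n)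
        simp only [sub_zero] at this
        rw [integral_const_mul, this]
        ring

lemma duhamel_nonneg {t : ℝ} (ht : 0 ≤ t) (hf : ∀ s, 0 ≤ s → ∀ z, 0 ≤ f s z) (z : ℝ) :
    0 ≤ duhamel σ f t z :=
  intervalIntegral.integral_nonneg ht fun s hs => heat_nonneg _ _ (hf s hs.1) z

lemma duhamel_reflect {c : ℝ} (hf : ∀ s x, f s (c + x) = f s (c - x)) (t x : ℝ) :
    duhamel σ f t (c + x) = duhamel σ f t (c - x) := by
  simp only [duhamel, fun s => heat_reflect σ (t - s) c (hf s) x]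

lemma SpatialC2.duhamel {K : ℝ} {n : ℕ} (h : SpatialC2 (fun s => K * |s| ^ n) f f₁ f₂) :
    SpatialC2 (fun t => K / (n + 1) * |t| ^ (n + 1))
      (duhamel σ f) (duhamel σ f₁) (duhamel σ f₂) := by
  have hB : Continuous fun s : ℝ => K * |s| ^ n := by fun_prop
  exact ⟨continuous_duhamel h.cont hB h.bound, continuous_duhamel h.cont₁ hB h.bound₁,
    continuous_duhamel h.cont₂ hB h.bound₂,
    hasDerivAt_duhamel h.cont h.cont₁ h.hasDerivAt hB h.bound h.bound₁,
    hasDerivAt_duhamel h.cont₁ h.cont₂ h.hasDerivAt₁ hB h.bound₁ h.bound₂,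
    abs_duhamel_le h.bound, abs_duhamel_le h.bound₁, abs_duhamel_le h.bound₂⟩

/-- The Duhamel integral solves the inhomogeneous heat equation. -/
lemma SpatialC2.hasDerivAt_duhamel_time (h : SpatialC2 B f f₁ f₂) (hB : Continuous B)
    {t : ℝ} (ht : 0 < t) (z : ℝ) :
    HasDerivAt (fun t => _root_.duhamel σ f t z)
      (σ ^ 2 / 2 * _root_.duhamel σ f₂ t z + f t z) t := by
  let Ψ : ℝ → ℝ → ℝ := fun s r => σ ^ 2 / 2 * heat σ r (f₂ s) z
  have hΨ : Continuous fun p : ℝ × ℝ => Ψ p.1 p.2 :=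
    continuous_const.mul ((continuous_heat σ h.cont₂ hB h.bound₂).comp
      (by fun_prop : Continuous fun p : ℝ × ℝ => (p.2, p.1, z)))
  have hF := hasDerivAt_integral_zero_self
    (F := fun t s => f s z + ∫ r in (0 : ℝ)..(t - s), Ψ s r) (F' := fun t s => Ψ s (t - s))
    (?_) (hΨ.comp (by fun_prop : Continuous fun p : ℝ × ℝ => (p.2, p.1 - p.2))) (fun t s => ?_) t
  · refine (hF.congr_of_eventuallyEq ?_).congr_deriv ?_
    · filter_upwards [lt_mem_nhds ht] with t ht
      refine intervalIntegral.integral_congr fun s hs => ?_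
      rw [uIcc_of_le ht.le] at hs
      exact heat_eq_add_integral σ (sub_nonneg.2 hs.2) (h.hasDerivAt s) (h.hasDerivAt₁ s)
        (h.cont₂.comp (by fun_prop : Continuous fun z : ℝ => (s, z))) (h.bound s) (h.bound₁ s)
        (h.bound₂ s) z
    · simp only [sub_self, intervalIntegral.integral_same, Ψ,
        intervalIntegral.integral_const_mul, _root_.duhamel]
      ring
  · exact (h.cont.comp (by fun_prop : Continuous fun p : ℝ × ℝ => (p.2, z))).add
      (intervalIntegral.continuous_parametric_intervalIntegral_of_continuous
        (f := fun (p : ℝ × ℝ) r => Ψ p.2 r)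
        (hΨ.comp (by fun_prop : Continuous fun q : (ℝ × ℝ) × ℝ => (q.1.2, q.2))) (by fun_prop))
  · have hc : Continuous (Ψ s) := hΨ.comp (by fun_prop : Continuous fun r : ℝ => (s, r))
    have := (intervalIntegral.integral_hasDerivAt_right (hc.intervalIntegrable 0 (t - s))
      (hc.stronglyMeasurableAtFilter _ _) hc.continuousAt)
    exact (this.comp_sub_const t s).const_add _

end Duhamel

/-- The terms of the Dyson series for `∂ₜ v = (σ²/2) ∂_zz v + V v`, `v(0, ·) = 1`. -/
noncomputable def dysonTerm (σ : ℝ) (V : ℝ → ℝ) : ℕ → ℝ → ℝ → ℝ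
  | 0 => fun _ _ => 1
  | n + 1 => duhamel σ fun s z => V z * dysonTerm σ V n s z

/-- The inhomogeneity in the heat equation solved by `dysonTerm`. -/
noncomputable def dysonSource (σ : ℝ) (V : ℝ → ℝ) : ℕ → ℝ → ℝ → ℝ
  | 0 => fun _ _ => 0
  | n + 1 => fun s z => V z * dysonTerm σ V n s z

section Dyson

variable {σ M : ℝ} {V V₁ V₂ : ℝ → ℝ}

lemma SpatialC2.potential_mul {B : ℝ → ℝ} {f f₁ f₂ : ℝ → ℝ → ℝ} (h : SpatialC2 B f f₁ f₂)
    (hV : ∀ z, HasDerivAt V (V₁ z) z) (hV₁ : ∀ z, HasDerivAt V₁ (V₂ z) z)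
    (hV₂ : Continuous V₂) (hM : ∀ z, |V z| ≤ M) (hM₁ : ∀ z, |V₁ z| ≤ M) (hM₂ : ∀ z, |V₂ z| ≤ M) :
    SpatialC2 (fun t => 4 * M * B t) (fun t z => V z * f t z)
      (fun t z => V₁ z * f t z + V z * f₁ t z)
      (fun t z => V₂ z * f t z + 2 * (V₁ z * f₁ t z) + V z * f₂ t z) := by
  have hVc : Continuous V := continuous_iff_continuousAt.2 fun z => (hV z).continuousAt
  have hVc₁ : Continuous V₁ := continuous_iff_continuousAt.2 fun z => (hV₁ z).continuousAt
  have hc := h.cont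
  have hc₁ := h.cont₁
  have hc₂ := h.cont₂
  have hM0 : 0 ≤ M := (abs_nonneg _).trans (hM 0)
  have hB0 : ∀ t, 0 ≤ M * B t := fun t => mul_nonneg hM0 ((abs_nonneg _).trans (h.bound t 0))
  have hmul : ∀ {a b : ℝ} (t : ℝ), |a| ≤ M → |b| ≤ B t → |a * b| ≤ M * B t := by
    intro a b t ha hb
    rw [abs_mul]
    exact mul_le_mul ha hb (abs_nonneg _) hM0
  refine ⟨by fun_prop, by fun_prop, by fun_prop,
    fun t z => (hV z).mul (h.hasDerivAt t z), fun t z => ?_, fun t z => ?_, fun t z => ?_,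
    fun t z => ?_⟩
  · exact (((hV₁ z).mul (h.hasDerivAt t z)).add
      ((hV z).mul (h.hasDerivAt₁ t z))).congr_deriv (by ring)
  · linarith [hmul t (hM z) (h.bound t z), hB0 t]
  · linarith [hmul t (hM₁ z) (h.bound t z), hmul t (hM z) (h.bound₁ t z), hB0 t,
      abs_add_le (V₁ z * f t z) (V z * f₁ t z)]
  · have h2 : |2 * (V₁ z * f₁ t z)| = 2 * |V₁ z * f₁ t z| := by rw [abs_mul, abs_two]
    linarith [hmul t (hM₂ z) (h.bound t z), hmul t (hM₁ z) (h.bound₁ t z),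
      hmul t (hM z) (h.bound₂ t z),
      abs_add_three (V₂ z * f t z) (2 * (V₁ z * f₁ t z)) (V z * f₂ t z)]

lemma exists_spatialC2_dysonTerm
    (hV : ∀ z, HasDerivAt V (V₁ z) z) (hV₁ : ∀ z, HasDerivAt V₁ (V₂ z) z)
    (hV₂ : Continuous V₂) (hM : ∀ z, |V z| ≤ M) (hM₁ : ∀ z, |V₁ z| ≤ M) (hM₂ : ∀ z, |V₂ z| ≤ M)
    (n : ℕ) :
    ∃ q r : ℝ → ℝ → ℝ,
      SpatialC2 (fun t => (4 * M) ^ n / n.factorial * |t| ^ n) (dysonTerm σ V n) q r ∧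
      ∀ t, 0 < t → ∀ z, HasDerivAt (fun t => dysonTerm σ V n t z)
        (σ ^ 2 / 2 * r t z + dysonSource σ V n t z) t := by
  induction n with
  | zero =>
    refine ⟨fun _ _ => 0, fun _ _ => 0, ?_, fun t _ z => ?_⟩
    · constructor <;> simp [dysonTerm, continuous_const, hasDerivAt_const]
    · simpa [dysonTerm, dysonSource] using hasDerivAt_const t (1 : ℝ)
  | succ n ih =>
    obtain ⟨q, r, h, -⟩ := ih
    have h' := h.potential_mul hV hV₁ hV₂ hM hM₁ hM₂
    have hB : (fun t : ℝ => 4 * M * ((4 * M) ^ n / n.factorial * |t| ^ n)) =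
        fun t => 4 * M * ((4 * M) ^ n / n.factorial) * |t| ^ n := by
      ext t; ring
    rw [hB] at h'
    have hD := h'.duhamel (σ := σ)
    have hB' : (fun t : ℝ => 4 * M * ((4 * M) ^ n / n.factorial) / (n + 1) * |t| ^ (n + 1)) =
        fun t => (4 * M) ^ (n + 1) / (n + 1).factorial * |t| ^ (n + 1) := by
      ext t
      rw [Nat.factorial_succ]
      push_cast
      field_simp
      ring
    rw [hB'] at hD
    exact ⟨_, _, hD, fun t ht z => h'.hasDerivAt_duhamel_time (by fun_prop) ht z⟩

lemma dysonTerm_nonneg (hV : ∀ z, 0 ≤ V z) (n : ℕ) {t : ℝ} (ht : 0 ≤ t) (z : ℝ) :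
    0 ≤ dysonTerm σ V n t z := by
  induction n generalizing t z with
  | zero => simp [dysonTerm]
  | succ n ih => exact duhamel_nonneg ht (fun s hs z => mul_nonneg (hV z) (ih hs z)) z

lemma dysonTerm_reflect {c : ℝ} (hV : ∀ x, V (c + x) = V (c - x)) (n : ℕ) (t x : ℝ) :
    dysonTerm σ V n t (c + x) = dysonTerm σ V n t (c - x) := by
  induction n generalizing t x with
  | zero => rfl
  | succ n ih => exact duhamel_reflect (fun s x => by rw [hV, ih]) t x

lemma dysonTerm_succ_zero (n : ℕ) (z : ℝ) : dysonTerm σ V (n + 1) 0 z = 0 := by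
  simp [dysonTerm, duhamel]

end Dyson

lemma continuous_tsum_of_le_pow {a : ℕ → ℝ} (ha : ∀ n, 0 ≤ a n)
    (hs : ∀ T : ℝ, Summable fun n => a n * T ^ n) {f : ℕ → ℝ → ℝ → ℝ}
    (hf : ∀ n, Continuous fun p : ℝ × ℝ => f n p.1 p.2)
    (hb : ∀ n t z, |f n t z| ≤ a n * |t| ^ n) :
    Continuous fun p : ℝ × ℝ => ∑' n, f n p.1 p.2 := by
  rw [continuous_iff_continuousAt]
  rintro ⟨t₀, z₀⟩
  have hopen : IsOpen {p : ℝ × ℝ | |p.1| < |t₀| + 1} :=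
    isOpen_lt (by fun_prop) continuous_const
  refine (continuousOn_tsum (fun n => (hf n).continuousOn) (hs (|t₀| + 1))
    fun n p hp => ?_).continuousAt (hopen.mem_nhds (by simp))
  refine (hb n p.1 p.2).trans ?_
  have hp' : |p.1| ≤ |t₀| + 1 := le_of_lt hp
  have := ha n
  gcongr

/-- Classical solvability of the linear heat equation with a smooth bounded nonnegative potential,
symmetric about `c`, started from the constant `1`. -/
lemma exists_heat_potential_solution (σ c : ℝ) {M : ℝ} {V V₁ V₂ : ℝ → ℝ}
    (hV : ∀ z, HasDerivAt V (V₁ z) z) (hV₁ : ∀ z, HasDerivAt V₁ (V₂ z) z)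
    (hV₂ : Continuous V₂) (hM : ∀ z, |V z| ≤ M) (hM₁ : ∀ z, |V₁ z| ≤ M) (hM₂ : ∀ z, |V₂ z| ≤ M)
    (hV0 : ∀ z, 0 ≤ V z) (hVc : ∀ x, V (c + x) = V (c - x)) :
    ∃ v v₁ v₂ : ℝ → ℝ → ℝ,
      (Continuous fun p : ℝ × ℝ => v p.1 p.2) ∧ (Continuous fun p : ℝ × ℝ => v₁ p.1 p.2) ∧
      (Continuous fun p : ℝ × ℝ => v₂ p.1 p.2) ∧
      (∀ t z, HasDerivAt (v t) (v₁ t z) z) ∧ (∀ t z, HasDerivAt (v₁ t) (v₂ t z) z) ∧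
      (∀ t, 0 < t → ∀ z,
        HasDerivAt (fun t => v t z) (σ ^ 2 / 2 * v₂ t z + V z * v t z) t) ∧
      (∀ z, v 0 z = 1) ∧ (∀ t, 0 ≤ t → ∀ z, 1 ≤ v t z) ∧
      (∀ t x, v t (c + x) = v t (c - x)) ∧
      ∀ T, ∃ C, ∀ t, |t| ≤ T → ∀ z, |v₁ t z| ≤ C := by
  choose q r h ht using exists_spatialC2_dysonTerm (σ := σ) hV hV₁ hV₂ hM hM₁ hM₂
  have hM0 : 0 ≤ M := (abs_nonneg _).trans (hM 0)
  have ha : ∀ n : ℕ, 0 ≤ (4 * M) ^ n / n.factorial := fun n => by positivity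
  have hs : ∀ T : ℝ, Summable fun n : ℕ => (4 * M) ^ n / n.factorial * T ^ n := fun T => by
    refine (Real.summable_pow_div_factorial (4 * M * T)).congr fun n => ?_
    rw [mul_pow]; ring
  have hle : ∀ (n : ℕ) {t T : ℝ}, |t| ≤ T →
      (4 * M) ^ n / n.factorial * |t| ^ n ≤ (4 * M) ^ n / n.factorial * T ^ n := fun n t T htT => by
    have := ha n
    gcongr
  have hsum : ∀ {f : ℕ → ℝ → ℝ → ℝ},
      (∀ n t z, |f n t z| ≤ (4 * M) ^ n / n.factorial * |t| ^ n) →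
      ∀ t z, Summable fun n => f n t z := fun hf t z =>
    .of_norm_bounded (hs |t|) fun n => hf n t z
  have hb := fun n => (h n).bound
  have hb₁ := fun n => (h n).bound₁
  have hb₂ := fun n => (h n).bound₂
  have hzero : ∀ z, ∑' n, dysonTerm σ V n 0 z = 1 := fun z => by
    rw [tsum_eq_single 0]
    · rfl
    · rintro (_ | n) hn
      · exact absurd rfl hn
      · exact dysonTerm_succ_zero n z
  refine ⟨fun t z => ∑' n, dysonTerm σ V n t z, fun t z => ∑' n, q n t z,
    fun t z => ∑' n, r n t z, continuous_tsum_of_le_pow ha hs (fun n => (h n).cont) hb,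
    continuous_tsum_of_le_pow ha hs (fun n => (h n).cont₁) hb₁,
    continuous_tsum_of_le_pow ha hs (fun n => (h n).cont₂) hb₂, fun t z => ?_, fun t z => ?_,
    fun t htpos z => ?_, hzero, fun t ht0 z => ?_, fun t x => ?_, fun T => ?_⟩
  · exact hasDerivAt_tsum (hs |t|) (fun n z => (h n).hasDerivAt t z) (fun n z => hb₁ n t z)
      (hsum hb t z) z
  · exact hasDerivAt_tsum (hs |t|) (fun n z => (h n).hasDerivAt₁ t z) (fun n z => hb₂ n t z)
      (hsum hb₁ t z) z
  · let u : ℕ → ℝ := fun n => Nat.casesOn n 0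
      fun n => M * ((4 * M) ^ n / n.factorial * (t + 1) ^ n)
    have hu : Summable u := (summable_nat_add_iff 1).1 ((hs (t + 1)).mul_left M)
    have hsrc : ∀ n, ∀ s ∈ Ioo 0 (t + 1), |dysonSource σ V n s z| ≤ u n := by
      rintro (_ | n) s hs'
      · simp [dysonSource, u]
      · simp only [dysonSource, u, abs_mul]
        exact mul_le_mul (hM z) ((hb n s z).trans (hle n (by
          rw [abs_of_pos hs'.1]; exact hs'.2.le))) (abs_nonneg _) hM0
    have hmem : t ∈ Ioo 0 (t + 1) := ⟨htpos, lt_add_one t⟩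
    have hd := hasDerivAt_tsum_of_isPreconnected
      (((hs (t + 1)).mul_left (σ ^ 2 / 2)).add hu) isOpen_Ioo isPreconnected_Ioo
      (fun n s hs' => ht n s hs'.1 z) (fun n s hs' => ?_) hmem (hsum hb t z) hmem
    · refine hd.congr_deriv ?_
      have hsrcsum : Summable fun n => dysonSource σ V n t z :=
        .of_norm_bounded hu fun n => hsrc n t hmem
      rw [((hsum hb₂ t z).mul_left _).tsum_add hsrcsum, tsum_mul_left,
        hsrcsum.tsum_eq_zero_add]
      simp [dysonSource, tsum_mul_left]
    · refine (norm_add_le _ _).trans (add_le_add ?_ (hsrc n s hs'))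
      rw [Real.norm_eq_abs, abs_mul, abs_of_nonneg (by positivity : 0 ≤ σ ^ 2 / 2)]
      exact mul_le_mul_of_nonneg_left ((hb₂ n s z).trans (hle n (by
        rw [abs_of_pos hs'.1]; exact hs'.2.le))) (by positivity)
  · exact (hsum hb t z).le_tsum 0 fun n _ => dysonTerm_nonneg hV0 n ht0 z
  · exact tsum_congr fun n => dysonTerm_reflect hVc n t x
  · exact ⟨∑' n : ℕ, (4 * M) ^ n / n.factorial * T ^ n, fun t htT z =>
      tsum_of_norm_bounded (f := fun n => q n t z) (hs T).hasSum
      fun n => (hb₁ n t z).trans (hle n htT)⟩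

/-- The Gaussian `a exp(-(x - c)² / (2ε))` has bounded derivatives up to order two. -/
lemma exists_gaussian_derivs (a c : ℝ) {ε : ℝ} (hε : 0 < ε) :
    ∃ (M : ℝ) (V₁ V₂ : ℝ → ℝ),
      (∀ z, HasDerivAt (fun x => a * Real.exp (-(x - c) ^ 2 / (2 * ε))) (V₁ z) z) ∧
      (∀ z, HasDerivAt V₁ (V₂ z) z) ∧ Continuous V₂ ∧
      (∀ z, |a * Real.exp (-(z - c) ^ 2 / (2 * ε))| ≤ M) ∧ (∀ z, |V₁ z| ≤ M) ∧
      ∀ z, |V₂ z| ≤ M := by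
  let E : ℝ → ℝ := fun x => Real.exp (-(x - c) ^ 2 / (2 * ε))
  have hE : ∀ z, HasDerivAt E (-((z - c) / ε) * E z) z := fun z => by
    have h1 : HasDerivAt (fun x : ℝ => -(x - c) ^ 2 / (2 * ε)) (-((z - c) / ε)) z := by
      refine ((((hasDerivAt_id z).sub_const c).pow 2).neg.div_const (2 * ε)).congr_deriv ?_
      simp only [id]
      field_simp
      simp [mul_comm]
    exact h1.exp.congr_deriv (mul_comm _ _)
  have hE0 : ∀ z, 0 < E z := fun z => Real.exp_pos _
  have hE1 : ∀ z, E z ≤ 1 := fun z =>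
    Real.exp_le_one_iff.2 (div_nonpos_of_nonpos_of_nonneg (by nlinarith [sq_nonneg (z - c)])
      (by positivity))
  have hE2 : ∀ z, (z - c) ^ 2 / (2 * ε) * E z ≤ 1 := fun z => by
    have h1 := Real.add_one_le_exp ((z - c) ^ 2 / (2 * ε))
    have h2 : Real.exp ((z - c) ^ 2 / (2 * ε)) * E z = 1 := by
      rw [← Real.exp_add, neg_div, add_neg_cancel, Real.exp_zero]
    nlinarith [hE0 z]
  have hsq : ∀ z, (z - c) ^ 2 / ε ^ 2 * E z ≤ 2 / ε := fun z => by
    calc (z - c) ^ 2 / ε ^ 2 * E z = 2 / ε * ((z - c) ^ 2 / (2 * ε) * E z) := by field_simp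
      _ ≤ 2 / ε * 1 := mul_le_mul_of_nonneg_left (hE2 z) (by positivity)
      _ = 2 / ε := mul_one _
  have hlin : ∀ z, |(z - c) / ε| * E z ≤ 1 + 2 / ε := fun z => by
    have h1 : |(z - c) / ε| ≤ 1 + (z - c) ^ 2 / ε ^ 2 := by
      rw [← div_pow, ← sq_abs ((z - c) / ε)]
      nlinarith [sq_nonneg (|(z - c) / ε| - 1), abs_nonneg ((z - c) / ε)]
    nlinarith [mul_le_mul_of_nonneg_right h1 (hE0 z).le, hE1 z, hsq z]
  have hε0 : 0 < 1 / ε := by positivity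
  have hsum : 2 / ε = 1 / ε + 1 / ε := by ring
  have key : ∀ {x : ℝ}, |x| ≤ 1 + 3 / ε → |a * x| ≤ |a| * (1 + 3 / ε) := fun hx => by
    rw [abs_mul]; exact mul_le_mul_of_nonneg_left hx (abs_nonneg a)
  have h3 : 3 / ε = 1 / ε + 1 / ε + 1 / ε := by ring
  refine ⟨|a| * (1 + 3 / ε), fun z => a * (-((z - c) / ε) * E z),
    fun z => a * ((z - c) ^ 2 / ε ^ 2 * E z - 1 / ε * E z), fun z => (hE z).const_mul a,
    fun z => ?_, by fun_prop, fun z => key ?_, fun z => key ?_, fun z => key ?_⟩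
  · have h1 : HasDerivAt (fun z : ℝ => -((z - c) / ε)) (-(1 / ε)) z :=
      (((hasDerivAt_id z).sub_const c).div_const ε).neg
    refine ((h1.mul (hE z)).const_mul a).congr_deriv ?_
    field_simp
    ring
  · rw [abs_of_pos (hE0 z)]
    linarith [hE1 z]
  · rw [abs_mul, abs_neg, abs_of_pos (hE0 z)]
    linarith [hlin z]
  · have h4 : 1 / ε * E z ≤ 1 / ε := by nlinarith [hE1 z]
    have h5 : 0 ≤ 1 / ε * E z := mul_nonneg hε0.le (hE0 z).le
    have h6 : 0 ≤ (z - c) ^ 2 / ε ^ 2 * E z := mul_nonneg (by positivity) (hE0 z).le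
    rw [abs_le]
    constructor <;> linarith [hsq z]
/-- Existence of a classical solution to the regularized HJB equation:
for every ε > 0 there exists u : [0,∞) × ℝ → ℝ such that
(i) u is continuous on [0,∞) × ℝ with u(0,z) = 0;
(ii) u has continuous partial derivatives ∂_t u, ∂_z u, ∂_zz u on (0,∞) × ℝ;
(iii) ∂_t u = (σ²/2)·∂_zz u + G_ε + (γ²/(4κ))·(∂_z u)² on (0,∞) × ℝ;
(iv) u(t, c+x) = u(t, c−x), in particular ∂_z u(t,c) = 0 for t > 0;
(v) u ≥ 0; (vi) for every T > 0, ∂_z u is bounded on (0,T] × ℝ. -/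
theorem regularized_HJB_classical_solution
    (σ γ κ c : ℝ) (hσ : 0 < σ) (hγ : 0 < γ) (hκ : 0 < κ)
    (β : ℝ) (hβ : β = γ ^ 2 / (2 * κ * σ ^ 2))
    (ε : ℝ) (hε : 0 < ε)
    (Gε : ℝ → ℝ)
    (hGε : ∀ x : ℝ, Gε x =
      (1 / Real.sqrt (2 * Real.pi * ε)) * Real.exp (-(x - c) ^ 2 / (2 * ε))) :
    ∃ u ut uz uzz : ℝ → ℝ → ℝ,
      -- (i)
      ContinuousOn (fun p : ℝ × ℝ => u p.1 p.2) (Set.Ici 0 ×ˢ Set.univ) ∧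
      (∀ z : ℝ, u 0 z = 0) ∧
      -- (ii)
      (∀ t : ℝ, 0 < t → ∀ z : ℝ,
        HasDerivAt (fun s => u s z) (ut t z) t ∧
        HasDerivAt (fun w => u t w) (uz t z) z ∧
        HasDerivAt (fun w => uz t w) (uzz t z) z) ∧
      ContinuousOn (fun p : ℝ × ℝ => ut p.1 p.2) (Set.Ioi 0 ×ˢ Set.univ) ∧
      ContinuousOn (fun p : ℝ × ℝ => uz p.1 p.2) (Set.Ioi 0 ×ˢ Set.univ) ∧
      ContinuousOn (fun p : ℝ × ℝ => uzz p.1 p.2) (Set.Ioi 0 ×ˢ Set.univ) ∧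
      -- (iii)
      (∀ t : ℝ, 0 < t → ∀ z : ℝ,
        ut t z = σ ^ 2 / 2 * uzz t z + Gε z + γ ^ 2 / (4 * κ) * (uz t z) ^ 2) ∧
      -- (iv)
      (∀ t : ℝ, 0 ≤ t → ∀ x : ℝ, u t (c + x) = u t (c - x)) ∧
      (∀ t : ℝ, 0 < t → uz t c = 0) ∧
      -- (v)
      (∀ t : ℝ, 0 ≤ t → ∀ z : ℝ, 0 ≤ u t z) ∧
      -- (vi)
      (∀ T : ℝ, 0 < T → ∃ M : ℝ, ∀ t ∈ Set.Ioc (0:ℝ) T, ∀ z : ℝ, |uz t z| ≤ M) := by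
  have hβ0 : 0 < β := by rw [hβ]; positivity
  obtain ⟨M, V₁, V₂, hV, hV₁, hV₂, hM, hM₁, hM₂⟩ :=
    exists_gaussian_derivs (β * (1 / √(2 * Real.pi * ε))) c hε
  obtain ⟨v, v₁, v₂, hc, hc₁, hc₂, hd, hd₁, hdt, hv0, hv1, hvc, hvb⟩ :=
    exists_heat_potential_solution σ c hV hV₁ hV₂ hM hM₁ hM₂ (fun z => by positivity)
      (fun x => by simp)
  have hGV : ∀ z, β * (1 / √(2 * Real.pi * ε)) * Real.exp (-(z - c) ^ 2 / (2 * ε)) =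
      β * Gε z := fun z => by rw [hGε]; ring
  have hpos : ∀ t, 0 ≤ t → ∀ z, 0 < v t z := fun t ht z => one_pos.trans_le (hv1 t ht z)
  have hne : ∀ p ∈ Ioi (0 : ℝ) ×ˢ (univ : Set ℝ), v p.1 p.2 ≠ 0 := fun p hp =>
    (hpos p.1 (le_of_lt hp.1) p.2).ne'
  refine ⟨fun t z => Real.log (v t z) / β,
    fun t z => (σ ^ 2 / 2 * v₂ t z + β * Gε z * v t z) / v t z / β,
    fun t z => v₁ t z / v t z / β,
    fun t z => (v₂ t z * v t z - v₁ t z * v₁ t z) / v t z ^ 2 / β,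
    ?_, fun z => by simp [hv0], fun t ht z => ⟨?_, ?_, ?_⟩, ?_, ?_, ?_, fun t ht z => ?_,
    fun t _ x => by simp only [hvc], fun t ht => ?_, fun t ht z => ?_, fun T hT => ?_⟩
  · exact (hc.continuousOn.log fun p hp => (hpos p.1 hp.1 p.2).ne').div_const β
  · have := hdt t ht z
    rw [hGV] at this
    exact (this.log (hpos t ht.le z).ne').div_const β
  · exact ((hd t z).log (hpos t ht.le z).ne').div_const β
  · exact ((hd₁ t z).div (hd t z) (hpos t ht.le z).ne').div_const β
  · have hG : Continuous Gε := by
      rw [funext hGε]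
      fun_prop
    exact ((by fun_prop : Continuous fun p : ℝ × ℝ =>
      σ ^ 2 / 2 * v₂ p.1 p.2 + β * Gε p.2 * v p.1 p.2).continuousOn.div hc.continuousOn
        hne).div_const β
  · exact (hc₁.continuousOn.div hc.continuousOn hne).div_const β
  · exact ((by fun_prop : Continuous fun p : ℝ × ℝ =>
      v₂ p.1 p.2 * v p.1 p.2 - v₁ p.1 p.2 * v₁ p.1 p.2).continuousOn.div (hc.pow 2).continuousOn
        fun p hp => pow_ne_zero 2 (hne p hp)).div_const β
  · have h1 := (hpos t ht.le z).ne'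
    have h2 : γ ^ 2 / (4 * κ) = β * σ ^ 2 / 2 := by
      rw [hβ]
      field_simp
      norm_num
    rw [h2]
    field_simp
    ring
  · have h1 : HasDerivAt (fun x => v t (c + x)) (v₁ t c) 0 :=
      HasDerivAt.comp_const_add c 0 (by simpa using hd t c)
    have h2 : HasDerivAt (fun x => v t (c - x)) (-v₁ t c) 0 :=
      HasDerivAt.comp_const_sub c 0 (by simpa using hd t c)
    simp only [hvc] at h1
    have h3 : v₁ t c = 0 := by linarith [h1.unique h2]
    simp [h3]
  · exact div_nonneg (Real.log_nonneg (hv1 t ht z)) hβ0.le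
  · obtain ⟨C, hC⟩ := hvb T
    refine ⟨C / β, fun t ht z => ?_⟩
    have hv := hv1 t ht.1.le z
    rw [abs_div, abs_of_pos hβ0, abs_div, abs_of_pos (one_pos.trans_le hv)]
    exact div_le_div_of_nonneg_right ((div_le_self (abs_nonneg _) hv).trans
      (hC t (by rw [abs_of_pos ht.1]; exact ht.2) z)) hβ0.le
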